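/- Let l_i = 1 if i ∉ S and l_i = a_i if i ∈ S. The number of (a_1,…,a_k,S)-derangements equals Σ over all tuples (b_1,…,b_k) with 0 ≤ b_m ≤ l_m of (−1)^{b_1+⋯+b_k} · multinomial((a_1−b_1)+⋯+(a_k−b_k); a_1−b_1, …, a_k−b_k). -/

import Mathlib

/-- Apply a permutation of `Fin n` to a natural number (0-based indexing);
indices `≥ n` are left fixed. -/
def appl {n : ℕ} (π : Equiv.Perm (Fin n)) (j : ℕ) : ℕ :=
  if h : j < n then ((π ⟨j, h⟩ : Fin n) : ℕ) else j

/-- The starting index (0-based) of the `i`-th consecutive block when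
`{0,…,n-1}` is partitioned into blocks of sizes `a 0, …, a (k-1)`. -/
def blockStart {k : ℕ} (a : Fin k → ℕ) (i : Fin k) : ℕ := ∑ t ∈ Finset.Iio i, a t

/-- `x` lies in the `i`-th block. -/
def inBlock {k : ℕ} (a : Fin k → ℕ) (i : Fin k) (x : ℕ) : Prop :=
  blockStart a i ≤ x ∧ x < blockStart a i + a i

instance {k : ℕ} (a : Fin k → ℕ) (i : Fin k) : DecidablePred (inBlock a i) := fun x =>
  inferInstanceAs (Decidable (blockStart a i ≤ x ∧ x < blockStart a i + a i))

/-- An `(a₁,…,a_k,S)`-permutation: a permutation of `{0,…,n-1}` (where `n = ∑ aᵢ`)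
that is strictly decreasing on each block `Aᵢ` with `i ∈ S` and strictly
increasing on each block `Aᵢ` with `i ∉ S`. -/
def IsASPerm {k : ℕ} (a : Fin k → ℕ) (S : Finset (Fin k))
    (π : Equiv.Perm (Fin (∑ t, a t))) : Prop :=
  ∀ i : Fin k, ∀ j : ℕ, blockStart a i ≤ j → j + 1 < blockStart a i + a i →
    if i ∈ S then appl π (j + 1) < appl π j else appl π j < appl π (j + 1)

/-- The number of `(a,S)`-derangements. -/
noncomputable def numDer (k : ℕ) (a : Fin k → ℕ) (S : Finset (Fin k)) : ℕ :=
  Nat.card {π : Equiv.Perm (Fin (∑ t, a t)) // IsASPerm a S π ∧ ∀ x, π x ≠ x}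

/-- Multinomial coefficient with integer entries: zero if any entry is negative. -/
noncomputable def multinomialZ {k : ℕ} (c : Fin k → ℤ) : ℤ :=
  if ∀ i, 0 ≤ c i then Nat.multinomial Finset.univ (fun i => (c i).toNat) else 0

open Finset

/-- `π` is strictly decreasing on the fibres of `β` over `S` and strictly increasing on the
other fibres. -/
def IsFiberMono {n k : ℕ} (β : Fin n → Fin k) (S : Finset (Fin k)) (π : Equiv.Perm (Fin n)) :
    Prop :=
  ∀ ⦃x y⦄, x < y → β x = β y → if β x ∈ S then π y < π x else π x < π y

/-- The number of permutations that are monotone on the fibres of `β` in the sense of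
`IsFiberMono` and have no fixed point in the fibres over `U`. -/
noncomputable def numFiberDer {n k : ℕ} (β : Fin n → Fin k) (S U : Finset (Fin k)) : ℕ :=
  Nat.card {π : Equiv.Perm (Fin n) // IsFiberMono β S π ∧ ∀ x, β x ∈ U → π x ≠ x}

/-- The cardinalities of the fibres of `β`. -/
def fiberCard {n k : ℕ} (β : Fin n → Fin k) (i : Fin k) : ℕ := #{x | β x = i}

/-- The permutation of `Fin (n + 1)` obtained from `π` by inserting the fixed point `p`. -/
def insertFixed {n : ℕ} (p : Fin (n + 1)) (π : Equiv.Perm (Fin n)) : Equiv.Perm (Fin (n + 1)) :=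
  ((finSuccEquiv' p).trans (Equiv.optionCongr π)).trans (finSuccEquiv' p).symm

section insertFixed

variable {n : ℕ} (p : Fin (n + 1)) (π : Equiv.Perm (Fin n))

@[simp]
lemma insertFixed_self : insertFixed p π p = p := by simp [insertFixed]

@[simp]
lemma insertFixed_succAbove (j : Fin n) :
    insertFixed p π (p.succAbove j) = p.succAbove (π j) := by simp [insertFixed]

lemma insertFixed_injective : Function.Injective (insertFixed p) := by
  intro π σ h
  ext1 j
  simpa using congrArg (fun τ => τ (p.succAbove j)) h

lemma exists_insertFixed_eq {τ : Equiv.Perm (Fin (n + 1))} (h : τ p = p) :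
    ∃ π, insertFixed p π = τ := by
  have hne (j : Fin n) : τ (p.succAbove j) ≠ p := fun hj =>
    Fin.succAbove_ne p j (τ.injective (hj.trans h.symm))
  choose g hg using fun j => Fin.exists_succAbove_eq (hne j)
  have hinj : Function.Injective g := fun j l hjl =>
    Fin.succAbove_right_injective (τ.injective (by rw [← hg, ← hg, hjl]))
  refine ⟨Equiv.ofBijective g (Finite.injective_iff_bijective.mp hinj), ?_⟩
  ext1 x
  rcases Fin.eq_self_or_eq_succAbove p x with rfl | ⟨j, rfl⟩
  · rw [insertFixed_self, h]
  · rw [insertFixed_succAbove, ← hg]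
    rfl

end insertFixed

section deleteOne

variable {n k : ℕ} {β : Fin (n + 1) → Fin k} {p q : Fin (n + 1)}

lemma comp_succAbove_eq_iff (hβ : Monotone β) (j : Fin n) :
    β (p.succAbove j) = β p ↔ β j.castSucc = β p ∧ β j.succ = β p := by
  have h1 : β j.castSucc ≤ β j.succ := hβ (Fin.castSucc_le_succ j)
  rcases Fin.castSucc_lt_or_lt_succ p j with h | h
  · have h2 : β j.succ ≤ β p := hβ (Fin.castSucc_lt_iff_succ_le.mp h)
    rw [Fin.succAbove_of_castSucc_lt _ _ h]
    grind
  · have h2 : β p ≤ β j.castSucc := hβ (Fin.le_castSucc_iff.mpr h)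
    rw [Fin.succAbove_of_lt_succ _ _ h]
    grind

lemma comp_succAbove_congr (hβ : Monotone β) (h : β p = β q) :
    β ∘ p.succAbove = β ∘ q.succAbove := by
  wlog hpq : p ≤ q generalizing p q
  · exact (this h.symm (le_of_not_ge hpq)).symm
  funext j
  simp only [Function.comp_apply]
  by_cases h1 : j.castSucc < p
  · rw [Fin.succAbove_of_castSucc_lt _ _ h1, Fin.succAbove_of_castSucc_lt _ _ (h1.trans_le hpq)]
  · by_cases h2 : j.castSucc < q
    · have h3 : β p ≤ β j.castSucc := hβ (not_lt.mp h1)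
      have h4 : β j.succ ≤ β q := hβ (Fin.castSucc_lt_iff_succ_le.mp h2)
      have h5 : β j.castSucc ≤ β j.succ := hβ (Fin.castSucc_le_succ j)
      rw [Fin.succAbove_of_le_castSucc _ _ (not_lt.mp h1), Fin.succAbove_of_castSucc_lt _ _ h2]
      order
    · rw [Fin.succAbove_of_le_castSucc _ _ (not_lt.mp h1),
        Fin.succAbove_of_le_castSucc _ _ (not_lt.mp h2)]

lemma fiberCard_eq_add_single (β : Fin (n + 1) → Fin k) (p : Fin (n + 1)) :
    fiberCard β = fiberCard (β ∘ p.succAbove) + Pi.single (β p) 1 := by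
  funext i
  simp only [fiberCard, card_filter, Fin.sum_univ_succAbove _ p, Pi.add_apply,
    Function.comp_apply, Pi.single_apply, eq_comm (a := i)]
  omega

/-- A block is cut by a property at no more than one position. -/
lemma cut_unique (hβ : Monotone β) {p₀ : Fin (n + 1)} {Q : Fin n → Prop}
    (hp : β p = β p₀) (hpQ : ∀ j, β (p₀.succAbove j) = β p₀ → (j.castSucc < p ↔ Q j))
    (hq : β q = β p₀) (hqQ : ∀ j, β (p₀.succAbove j) = β p₀ → (j.castSucc < q ↔ Q j)) :
    p = q := by
  wlog hpq : p ≤ q generalizing p q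
  · exact (this hq hqQ hp hpQ (le_of_not_ge hpq)).symm
  by_contra hne
  have hlt : p < q := lt_of_le_of_ne hpq hne
  obtain ⟨j, rfl⟩ := Fin.exists_castSucc_eq.mpr (hlt.trans_le (Fin.le_last q)).ne
  have h1 : β j.succ ≤ β q := hβ (Fin.castSucc_lt_iff_succ_le.mp hlt)
  have h2 : β j.castSucc ≤ β j.succ := hβ (Fin.castSucc_le_succ j)
  have hj : β (p₀.succAbove j) = β p₀ :=
    (comp_succAbove_eq_iff hβ j).mpr ⟨hp, by order⟩
  exact lt_irrefl _ ((hpQ j hj).mpr ((hqQ j hj).mp hlt))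

/-- A property on a block that is inherited by smaller elements cuts the block at some
position. -/
lemma exists_cut (hβ : Monotone β) (p₀ : Fin (n + 1)) (Q : Fin n → Prop)
    (hQ : ∀ j l, j ≤ l → β (p₀.succAbove j) = β p₀ → β (p₀.succAbove l) = β p₀ → Q l → Q j) :
    ∃ p, β p = β p₀ ∧ ∀ j, β (p₀.succAbove j) = β p₀ → (j.castSucc < p ↔ Q j) := by
  simp only [comp_succAbove_eq_iff hβ] at hQ ⊢
  classical
  let T : Finset (Fin (n + 1)) := {p | β p = β p₀ ∧
    ∀ j : Fin n, β j.castSucc = β p₀ ∧ β j.succ = β p₀ → Q j → j.castSucc < p}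
  have hT : T.Nonempty := by
    let B : Finset (Fin (n + 1)) := {p | β p = β p₀}
    have hB : B.Nonempty := ⟨p₀, by simp [B]⟩
    refine ⟨B.max' hB, ?_⟩
    have h1 : B.max' hB ∈ B := B.max'_mem hB
    simp only [B, mem_filter, mem_univ, true_and] at h1
    simp only [T, mem_filter, mem_univ, true_and]
    exact ⟨h1, fun j hj _ => (Fin.castSucc_lt_succ (i := j)).trans_le
      (B.le_max' _ (by simpa [B] using hj.2))⟩
  obtain ⟨hp1, hp2⟩ : β (T.min' hT) = β p₀ ∧ ∀ j : Fin n,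
      β j.castSucc = β p₀ ∧ β j.succ = β p₀ → Q j → j.castSucc < T.min' hT := by
    simpa [T] using T.min'_mem hT
  refine ⟨T.min' hT, hp1, fun j hj => ⟨fun hlt => ?_, hp2 j hj⟩⟩
  by_contra hn
  refine absurd (T.min'_le j.castSucc ?_) (not_le.mpr hlt)
  simp only [T, mem_filter, mem_univ, true_and]
  refine ⟨hj.1, fun l hl hQl => ?_⟩
  by_contra hlj
  exact hn (hQ j l (by simpa using hlj) hj hl hQl)

end deleteOne

section recursion

variable {n k : ℕ} {β : Fin n → Fin k} {S U : Finset (Fin k)} {π : Equiv.Perm (Fin n)}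

lemma IsFiberMono.add_sub_le (hβ : Monotone β) (h : IsFiberMono β S π) {j l : Fin n} (hjl : j ≤ l)
    (hb : β j = β l) (hS : β j ∉ S) : (π j : ℕ) + (l - j) ≤ π l := by
  obtain ⟨d, hd⟩ := Nat.exists_eq_add_of_le (Fin.le_def.mp hjl)
  induction d generalizing l with
  | zero =>
    obtain rfl : l = j := Fin.ext hd
    simp
  | succ d ih =>
    let m : Fin n := ⟨j + d, by omega⟩
    have hm1 : j ≤ m := Fin.le_def.mpr (by simp [m])
    have hm2 : m < l := Fin.lt_def.mpr (by simp only [m]; omega)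
    have h1 := hβ hm1
    have h2 := hβ hm2.le
    have hm3 : β j = β m := by order
    have h3 := ih hm1 hm3 rfl
    have h4 := h hm2 (hm3.symm.trans hb)
    rw [← hm3, if_neg hS, Fin.lt_def] at h4
    simp only [m] at h3 h4
    omega

lemma isFiberMono_insertFixed_iff {β : Fin (n + 1) → Fin k} {p : Fin (n + 1)} :
    IsFiberMono β S (insertFixed p π) ↔ IsFiberMono (β ∘ p.succAbove) S π ∧
      ∀ j, β (p.succAbove j) = β p →
        (j.castSucc < p ↔ if β p ∈ S then p ≤ (π j).castSucc else (π j).castSucc < p) := by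
  constructor
  · refine fun h => ⟨fun x y hxy hb => ?_, fun j hj => ?_⟩
    · simpa using h (Fin.strictMono_succAbove p hxy) hb
    · have h1 := @h (p.succAbove j) p
      have h2 := @h p (p.succAbove j)
      simp only [insertFixed_self, insertFixed_succAbove, Fin.succAbove_lt_iff_castSucc_lt,
        Fin.lt_succAbove_iff_le_castSucc, hj] at h1 h2
      grind
  · rintro ⟨h, hp⟩ x y hxy hb
    rcases Fin.eq_self_or_eq_succAbove p x with hx | ⟨j, rfl⟩ <;>
      rcases Fin.eq_self_or_eq_succAbove p y with hy | ⟨l, rfl⟩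
    · exact absurd hxy (by simp [hx, hy])
    · subst hx
      have := hp l hb.symm
      rw [Fin.lt_succAbove_iff_le_castSucc] at hxy
      simp only [insertFixed_self, insertFixed_succAbove, Fin.succAbove_lt_iff_castSucc_lt,
        Fin.lt_succAbove_iff_le_castSucc]
      grind
    · subst hy
      have := hp j hb
      rw [Fin.succAbove_lt_iff_castSucc_lt] at hxy
      simp only [insertFixed_self, insertFixed_succAbove, Fin.succAbove_lt_iff_castSucc_lt,
        Fin.lt_succAbove_iff_le_castSucc]
      grind
    · simpa using h (Fin.succAbove_lt_succAbove_iff.mp hxy) hb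

/-- `p` is the position in its block at which a fixed point can be inserted into `π` so that it
becomes the first fixed point of that block. -/
def IsCut (β : Fin (n + 1) → Fin k) (S : Finset (Fin k)) (π : Equiv.Perm (Fin n))
    (p : Fin (n + 1)) : Prop :=
  ∀ j, β (p.succAbove j) = β p → (j.castSucc < p ↔ if β p ∈ S then j < π j else π j < j)

lemma isFiberMono_insertFixed_iff_isCut {β : Fin (n + 1) → Fin k} (hβ : Monotone β)
    {p : Fin (n + 1)} :
    (IsFiberMono β S (insertFixed p π) ∧ ∀ x, β x = β p → insertFixed p π x = x → p ≤ x) ↔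
      IsFiberMono (β ∘ p.succAbove) S π ∧ IsCut β S π p ∧
        (β p ∈ S → ∀ j, β (p.succAbove j) = β p → π j ≠ j) := by
  have hβ' : Monotone (β ∘ p.succAbove) := hβ.comp (Fin.strictMono_succAbove p).monotone
  have hfirst : (∀ x, β x = β p → insertFixed p π x = x → p ≤ x) ↔
      ∀ j, β (p.succAbove j) = β p → π j = j → p ≤ j.castSucc := by
    have hle (j : Fin n) : p ≤ p.succAbove j ↔ p ≤ j.castSucc := by
      rw [← Fin.lt_succAbove_iff_le_castSucc, (Fin.succAbove_ne p j).symm.le_iff_lt]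
    rw [Fin.forall_iff_succAbove p]
    simp [hle]
  rw [isFiberMono_insertFixed_iff, hfirst, and_assoc, and_congr_right_iff]
  intro h
  have hpred (j : Fin n) (hj : β (p.succAbove j) = β p) (hlt : j.castSucc < p) :
      ∃ m : Fin n, j ≤ m ∧ m.succ = p ∧ β (p.succAbove m) = β p := by
    obtain ⟨m, rfl⟩ := Fin.exists_succ_eq.mpr (Fin.ne_zero_of_lt hlt)
    have hjm : j ≤ m := Fin.castSucc_lt_succ_iff.mp hlt
    refine ⟨m, hjm, rfl, (comp_succAbove_eq_iff hβ m).mpr ⟨?_, rfl⟩⟩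
    have h1 := ((comp_succAbove_eq_iff hβ j).mp hj).1
    have h2 : β j.castSucc ≤ β m.castSucc := hβ hjm
    have h3 : β m.castSucc ≤ β m.succ := hβ (Fin.castSucc_le_succ m)
    order
  have hself (j : Fin n) (hj : β (p.succAbove j) = β p) (hle : p ≤ j.castSucc) :
      ∃ m : Fin n, m ≤ j ∧ m.castSucc = p ∧ β (p.succAbove m) = β p := by
    obtain ⟨m, rfl⟩ := Fin.exists_castSucc_eq.mpr
      (hle.trans_lt (Fin.castSucc_lt_last j)).ne
    refine ⟨m, hle, rfl, (comp_succAbove_eq_iff hβ m).mpr ⟨rfl, ?_⟩⟩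
    have h1 := ((comp_succAbove_eq_iff hβ j).mp hj).2
    have h2 : β m.succ ≤ β j.succ := hβ (Fin.succ_le_succ_iff.mpr hle)
    have h3 : β m.castSucc ≤ β m.succ := hβ (Fin.castSucc_le_succ m)
    order
  unfold IsCut
  by_cases hS : β p ∈ S
  · simp only [hS, if_true, true_imp_iff]
    have hanti {j l : Fin n} (hj : β (p.succAbove j) = β p) (hl : β (p.succAbove l) = β p)
        (hjl : j ≤ l) : π l ≤ π j := by
      rcases hjl.eq_or_lt with rfl | hlt
      · exact le_rfl
      · have := h hlt (hj.trans hl.symm)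
        rw [Function.comp_apply, hj, if_pos hS] at this
        exact this.le
    constructor
    · rintro ⟨h1, -⟩
      refine ⟨fun j hj => ?_, fun j hj => ?_⟩ <;> have := h1 j hj <;> grind
    · rintro ⟨h1, h2⟩
      refine ⟨fun j hj => ⟨fun hlt => ?_, fun hle => ?_⟩, fun j hj hf => absurd hf (h2 j hj)⟩
      · obtain ⟨m, hjm, hm, hmb⟩ := hpred j hj hlt
        have h3 := (h1 m hmb).mp (hm ▸ Fin.castSucc_lt_succ)
        have h4 := hanti hj hmb hjm
        rw [← hm]
        grind
      · by_contra hlt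
        obtain ⟨m, hjm, hm, hmb⟩ := hself j hj (not_lt.mp hlt)
        have h3 := (h1 m hmb).not.mp (by simp [hm])
        have h4 := hanti hmb hj hjm
        have h5 := h2 m hmb
        rw [← hm] at hle
        grind
  · simp only [hS, if_false, false_imp_iff, and_true]
    have hgap {j l : Fin n} (hj : β (p.succAbove j) = β p) (hl : β (p.succAbove l) = β p)
        (hjl : j ≤ l) : (π j : ℕ) + (l - j) ≤ π l :=
      h.add_sub_le hβ' hjl (hj.trans hl.symm) (by rwa [Function.comp_apply, hj])
    constructor
    · rintro ⟨h1, h2⟩ j hj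
      constructor
      · intro hlt
        obtain ⟨m, hjm, hm, hmb⟩ := hpred j hj hlt
        have h3 := (h1 m hmb).mp (hm ▸ Fin.castSucc_lt_succ)
        have h4 := hgap hj hmb hjm
        have h5 := (h2 j hj).mt (not_le.mpr hlt)
        rw [← hm] at h3
        grind
      · intro hlt
        by_contra hle
        obtain ⟨m, hjm, hm, hmb⟩ := hself j hj (not_lt.mp hle)
        have h3 := (h1 m hmb).not.mp (by simp [hm])
        have h4 := hgap hmb hj hjm
        rw [← hm] at h3
        grind
    · intro h1
      refine ⟨fun j hj => ?_, fun j hj => ?_⟩ <;> have := h1 j hj <;> grind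

lemma isCut_congr {β : Fin (n + 1) → Fin k} (hβ : Monotone β) {p q : Fin (n + 1)}
    (h : β p = β q) : IsCut β S π p ↔
      ∀ j, β (q.succAbove j) = β q → (j.castSucc < p ↔ if β q ∈ S then j < π j else π j < j) := by
  have (j : Fin n) : β (p.succAbove j) = β (q.succAbove j) :=
    congrFun (comp_succAbove_congr hβ h) j
  simp only [IsCut, this, h]

lemma IsCut.eq {β : Fin (n + 1) → Fin k} (hβ : Monotone β) {p q : Fin (n + 1)}
    (h : β p = β q) (hp : IsCut β S π p) (hq : IsCut β S π q) : p = q :=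
  cut_unique hβ h ((isCut_congr hβ h).mp hp) rfl hq

lemma exists_isCut {β : Fin (n + 1) → Fin k} (hβ : Monotone β) (p₀ : Fin (n + 1))
    (h : IsFiberMono (β ∘ p₀.succAbove) S π) : ∃ p, β p = β p₀ ∧ IsCut β S π p := by
  have hβ' : Monotone (β ∘ p₀.succAbove) := hβ.comp (Fin.strictMono_succAbove p₀).monotone
  obtain ⟨p, hp, hcut⟩ := exists_cut hβ p₀ (fun j => if β p₀ ∈ S then j < π j else π j < j) <| by
    intro j l hjl hj hl
    by_cases hS : β p₀ ∈ S
    · rcases hjl.eq_or_lt with rfl | hlt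
      · exact id
      · have := h hlt (hj.trans hl.symm)
        simp only [Function.comp_apply, hj, hS, if_true] at this ⊢
        intro
        order
    · have := h.add_sub_le hβ' hjl (hj.trans hl.symm) (by rwa [Function.comp_apply, hj])
      simp only [hS, if_false]
      grind
  exact ⟨p, hp, (isCut_congr hβ hp).mpr hcut⟩

lemma forall_insertFixed_ne_iff {β : Fin (n + 1) → Fin k} {p : Fin (n + 1)} (hp : β p ∉ U) :
    (∀ x, β x ∈ U → insertFixed p π x ≠ x) ↔ ∀ j, (β ∘ p.succAbove) j ∈ U → π j ≠ j := by
  rw [Fin.forall_iff_succAbove p]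
  simp [hp]

open Classical in
lemma numFiberDer_eq_card (β : Fin n → Fin k) (S U : Finset (Fin k)) :
    numFiberDer β S U =
      #{π : Equiv.Perm (Fin n) | IsFiberMono β S π ∧ ∀ x, β x ∈ U → π x ≠ x} := by
  rw [numFiberDer, Nat.card_eq_fintype_card, Fintype.card_subtype]

open Classical in
/-- Deleting the first fixed point of a block is a bijection. -/
lemma card_exists_fixed {β : Fin (n + 1) → Fin k} (hβ : Monotone β) (p₀ : Fin (n + 1))
    (hU : β p₀ ∉ U) :
    #{π : Equiv.Perm (Fin (n + 1)) | (IsFiberMono β S π ∧ ∀ x, β x ∈ U → π x ≠ x) ∧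
        ∃ x, β x = β p₀ ∧ π x = x} =
      numFiberDer (β ∘ p₀.succAbove) S (if β p₀ ∈ S then insert (β p₀) U else U) := by
  have hmem (π : Equiv.Perm (Fin n)) : (∀ x, (β ∘ p₀.succAbove) x ∈
      (if β p₀ ∈ S then insert (β p₀) U else U) → π x ≠ x) ↔
        (β p₀ ∈ S → ∀ j, β (p₀.succAbove j) = β p₀ → π j ≠ j) ∧
          ∀ j, (β ∘ p₀.succAbove) j ∈ U → π j ≠ j := by
    by_cases hS : β p₀ ∈ S <;> simp [hS, or_imp, forall_and]
  have hkey (p : Fin (n + 1)) (hp : β p = β p₀) (π : Equiv.Perm (Fin n)) :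
      (IsFiberMono β S (insertFixed p π) ∧ ∀ x, β x = β p → insertFixed p π x = x → p ≤ x) ∧
        (∀ x, β x ∈ U → insertFixed p π x ≠ x) ↔
      IsCut β S π p ∧ IsFiberMono (β ∘ p₀.succAbove) S π ∧ ∀ x, (β ∘ p₀.succAbove) x ∈
        (if β p₀ ∈ S then insert (β p₀) U else U) → π x ≠ x := by
    have hc (j : Fin n) : β (p.succAbove j) = β (p₀.succAbove j) :=
      congrFun (comp_succAbove_congr hβ hp) j
    rw [hmem, isFiberMono_insertFixed_iff_isCut hβ, forall_insertFixed_ne_iff (hp ▸ hU),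
      comp_succAbove_congr hβ hp]
    simp only [hc, hp]
    tauto
  rw [numFiberDer_eq_card]
  symm
  have hex (π : Equiv.Perm (Fin n)) (hπ : IsFiberMono (β ∘ p₀.succAbove) S π) :=
    exists_isCut hβ p₀ hπ
  choose! c hc1 hc2 using hex
  refine card_bij (fun π _ => insertFixed (c π) π) ?_ ?_ ?_
  · intro π hπ
    rw [mem_filter_univ] at hπ ⊢
    obtain ⟨⟨h1, -⟩, h2⟩ := (hkey (c π) (hc1 π hπ.1) π).mpr ⟨hc2 π hπ.1, hπ⟩
    exact ⟨⟨h1, h2⟩, c π, hc1 π hπ.1, insertFixed_self _ _⟩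
  · intro π hπ σ hσ heq
    rw [mem_filter_univ] at hπ hσ
    obtain ⟨⟨-, h1⟩, -⟩ := (hkey (c π) (hc1 π hπ.1) π).mpr ⟨hc2 π hπ.1, hπ⟩
    obtain ⟨⟨-, h2⟩, -⟩ := (hkey (c σ) (hc1 σ hσ.1) σ).mpr ⟨hc2 σ hσ.1, hσ⟩
    have hb : β (c π) = β (c σ) := (hc1 π hπ.1).trans (hc1 σ hσ.1).symm
    have hcc : c π = c σ := le_antisymm
      (h1 _ hb.symm (by rw [heq, insertFixed_self]))
      (h2 _ hb (by rw [← heq, insertFixed_self]))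
    rw [hcc] at heq
    exact insertFixed_injective _ heq
  · intro τ hτ
    rw [mem_filter_univ] at hτ
    obtain ⟨⟨h1, h2⟩, x, hx1, hx2⟩ := hτ
    let F : Finset (Fin (n + 1)) := {x | β x = β p₀ ∧ τ x = x}
    have hF : F.Nonempty := ⟨x, by simp [F, hx1, hx2]⟩
    obtain ⟨hp1, hp2⟩ : β (F.min' hF) = β p₀ ∧ τ (F.min' hF) = F.min' hF := by
      simpa [F] using F.min'_mem hF
    obtain ⟨π, hπ⟩ := exists_insertFixed_eq _ hp2
    have h3 := (hkey (F.min' hF) hp1 π).mp ⟨⟨hπ ▸ h1, fun y hy1 hy2 =>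
      F.min'_le _ (by
        rw [hπ] at hy2
        simp only [F, mem_filter_univ]
        exact ⟨hy1.trans hp1, hy2⟩)⟩, hπ ▸ h2⟩
    refine ⟨π, by rw [mem_filter_univ]; exact h3.2, ?_⟩
    rw [IsCut.eq hβ ((hc1 π h3.2.1).trans hp1.symm) (hc2 π h3.2.1) h3.1, hπ]

lemma numFiberDer_eq_add {β : Fin (n + 1) → Fin k} (hβ : Monotone β) (p : Fin (n + 1))
    (hU : β p ∉ U) :
    numFiberDer β S U = numFiberDer β S (insert (β p) U) +
      numFiberDer (β ∘ p.succAbove) S (if β p ∈ S then insert (β p) U else U) := by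
  classical
  rw [← card_exists_fixed hβ p hU, numFiberDer_eq_card, numFiberDer_eq_card,
    ← card_filter_add_card_filter_not (fun π => ∃ x, β x = β p ∧ π x = x), filter_filter,
    filter_filter, add_comm #_]
  congr 2
  ext π
  simp only [mem_filter_univ, mem_insert, or_imp, forall_and, not_exists, not_and]
  tauto

lemma numFiberDer_insert_of_forall_ne {i : Fin k} (h : ∀ x, β x ≠ i) :
    numFiberDer β S (insert i U) = numFiberDer β S U := by
  simp [numFiberDer, h]

end recursion

section counting

variable {n k : ℕ} {β : Fin n → Fin k} {S : Finset (Fin k)}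

/-- The key by which `π` has to be sorted in order to become monotone on the fibres of `β`. -/
def fiberKey (β : Fin n → Fin k) (S : Finset (Fin k)) (π : Equiv.Perm (Fin n)) (x : Fin n) :
    Fin k ×ₗ ℤ :=
  toLex (β x, if β x ∈ S then -(π x : ℤ) else π x)

lemma isFiberMono_iff_monotone_fiberKey (hβ : Monotone β) (π : Equiv.Perm (Fin n)) :
    IsFiberMono β S π ↔ Monotone (fiberKey β S π) := by
  rw [monotone_iff_forall_lt]
  refine forall₃_congr fun x y hxy => ?_
  have h1 : β x ≤ β y := hβ hxy.le
  have h2 : (π x : ℕ) ≠ π y := fun h => hxy.ne (π.injective (Fin.ext h))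
  simp only [fiberKey, Prod.Lex.toLex_le_toLex, Fin.lt_def]
  rcases h1.lt_or_eq with hlt | heq
  · simp [hlt, hlt.ne]
  · simp only [heq, lt_irrefl, false_or, true_and, true_imp_iff]
    split_ifs <;> omega

lemma fiberKey_injective : Function.Injective (fiberKey β S) := by
  intro π σ h
  ext x
  have := congrArg (fun p => (ofLex p).2) (congrFun h x)
  simp only [fiberKey, ofLex_toLex] at this
  split_ifs at this <;> omega

lemma fiberKey_mul {σ : Equiv.Perm (Fin n)} (hσ : β ∘ σ = β) (π : Equiv.Perm (Fin n)) :
    fiberKey β S (π * σ) = fiberKey β S π ∘ σ := by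
  funext x
  have : β (σ x) = β x := congrFun hσ x
  simp [fiberKey, this]

/-- Every permutation factors uniquely through a permutation preserving the fibres. -/
lemma numFiberDer_empty_mul_prod (hβ : Monotone β) :
    numFiberDer β S ∅ * ∏ i, (fiberCard β i).factorial = n.factorial := by
  classical
  let f : {π : Equiv.Perm (Fin n) // IsFiberMono β S π} × {σ : Equiv.Perm (Fin n) // β ∘ σ = β} →
    Equiv.Perm (Fin n) := fun q => q.1.1 * q.2.1
  have hinv {σ : Equiv.Perm (Fin n)} (hσ : β ∘ σ = β) : β ∘ (σ⁻¹ : Equiv.Perm (Fin n)) = β := by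
    funext x
    simpa using (congrFun hσ (σ⁻¹ x)).symm
  have hf : Function.Bijective f := by
    constructor
    · rintro ⟨⟨π, hπ⟩, ⟨σ, hσ⟩⟩ ⟨⟨π', hπ'⟩, ⟨σ', hσ'⟩⟩ h
      replace h : π * σ = π' * σ' := h
      rw [isFiberMono_iff_monotone_fiberKey hβ] at hπ hπ'
      have h1 : fiberKey β S (π * σ) ∘ (σ⁻¹ : Equiv.Perm (Fin n)) = fiberKey β S π := by
        rw [← fiberKey_mul (hinv hσ), mul_inv_cancel_right]
      have h2 : fiberKey β S (π * σ) ∘ (σ'⁻¹ : Equiv.Perm (Fin n)) = fiberKey β S π' := by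
        rw [h, ← fiberKey_mul (hinv hσ'), mul_inv_cancel_right]
      obtain rfl : π = π' := fiberKey_injective (h1.symm.trans
        ((Tuple.unique_monotone (h1 ▸ hπ) (h2 ▸ hπ')).trans h2))
      obtain rfl : σ = σ' := mul_left_cancel h
      rfl
    · intro ρ
      let τ := Tuple.sort (fiberKey β S ρ)
      have hτ : Monotone (fiberKey β S ρ ∘ τ) := Tuple.monotone_sort _
      have hβτ : β ∘ τ = β := by
        refine Tuple.unique_monotone (τ := 1) (fun x y hxy => ?_) hβ
        have := hτ hxy
        simp only [fiberKey, Function.comp_apply, Prod.Lex.toLex_le_toLex] at this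
        exact this.elim le_of_lt fun h => h.1.le
      refine ⟨⟨⟨ρ * τ, ?_⟩, ⟨τ⁻¹, hinv hβτ⟩⟩, mul_inv_cancel_right ρ τ⟩
      rwa [isFiberMono_iff_monotone_fiberKey hβ, fiberKey_mul hβτ]
  have h := Nat.card_eq_of_bijective f hf
  have hstab := DomMulAct.stabilizer_card β
  rw [Nat.card_prod, Nat.card_eq_fintype_card (α := {σ : Equiv.Perm (Fin n) // β ∘ σ = β}), hstab,
    Nat.card_eq_fintype_card (α := Equiv.Perm (Fin n)), Fintype.card_perm, Fintype.card_fin] at h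
  simpa [numFiberDer, fiberCard, Fintype.card_subtype] using h

lemma numFiberDer_empty (hβ : Monotone β) :
    numFiberDer β S ∅ = Nat.multinomial univ (fiberCard β) := by
  have h1 := numFiberDer_empty_mul_prod (S := S) hβ
  have h2 := Nat.multinomial_spec univ (fiberCard β)
  have h3 : ∑ i, fiberCard β i = n := by
    simpa [fiberCard] using
      (card_eq_sum_card_fiberwise (f := β) (s := univ) (t := univ) (by simp)).symm
  rw [h3, ← h1, mul_comm] at h2
  exact (Nat.eq_of_mul_eq_mul_right
    (Finset.prod_pos fun i _ => Nat.factorial_pos _) h2).symm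

end counting

section alternatingSum

variable {k : ℕ}

lemma sum_Icc_add_single {M : Type*} [AddCommMonoid M] (l : Fin k → ℕ) (i : Fin k)
    (f : (Fin k → ℕ) → M) :
    ∑ b ∈ Icc 0 (l + Pi.single i 1), f b =
      ∑ b ∈ Icc 0 (Function.update l i 0), f b + ∑ b ∈ Icc 0 l, f (b + Pi.single i 1) := by
  rw [← sum_filter_add_sum_filter_not _ (fun b => b i = 0)]
  congr 1
  · refine sum_congr ?_ fun _ _ => rfl
    ext b
    simp only [mem_filter, mem_Icc, Pi.le_def]
    constructor
    · rintro ⟨⟨-, h1⟩, h2⟩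
      refine ⟨fun _ => Nat.zero_le _, fun j => ?_⟩
      rcases eq_or_ne j i with rfl | hj
      · simp [h2]
      · simpa [hj] using h1 j
    · rintro ⟨-, h1⟩
      refine ⟨⟨fun _ => Nat.zero_le _, fun j => ?_⟩, by simpa using h1 i⟩
      have := h1 j
      rcases eq_or_ne j i with rfl | hj
      · simp only [Function.update_self] at this
        omega
      · simpa [hj] using this
  · symm
    refine sum_bij (fun b _ => b + Pi.single i 1) ?_ (fun _ _ _ _ => add_right_cancel) ?_
      fun _ _ => rfl
    · intro b hb
      rw [mem_Icc] at hb
      simp only [mem_filter, mem_Icc, Pi.add_apply, Pi.single_eq_same]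
      exact ⟨⟨fun _ => Nat.zero_le _, add_le_add_left hb.2 _⟩, by omega⟩
    · intro b hb
      simp only [mem_filter, mem_Icc] at hb
      have hle : Pi.single i 1 ≤ b := by
        intro j
        rcases eq_or_ne j i with rfl | hj
        · simpa using Nat.one_le_iff_ne_zero.mpr hb.2
        · simp [hj]
      refine ⟨b - Pi.single i 1, mem_Icc.mpr ⟨fun _ => Nat.zero_le _, ?_⟩,
        tsub_add_cancel_of_le hle⟩
      exact tsub_le_iff_right.mpr hb.1.2

/-- The upper bounds of the alternating sum counting the permutations without fixed points in the
blocks in `U`. -/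
def sumBound (a : Fin k → ℕ) (S U : Finset (Fin k)) (i : Fin k) : ℕ :=
  if i ∈ U then if i ∈ S then a i else 1 else 0

/-- The alternating sum of multinomial coefficients counting the permutations without fixed points
in the blocks in `U`. -/
noncomputable def alternatingSum (a : Fin k → ℕ) (S U : Finset (Fin k)) : ℤ :=
  ∑ b ∈ Icc 0 (sumBound a S U), (-1) ^ (∑ i, b i) * multinomialZ (fun i => (a i : ℤ) - b i)

lemma multinomialZ_natCast (a : Fin k → ℕ) :
    multinomialZ (fun i => (a i : ℤ)) = Nat.multinomial univ a := by
  simp [multinomialZ]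

lemma multinomialZ_eq_zero {c : Fin k → ℤ} {i : Fin k} (h : c i < 0) : multinomialZ c = 0 :=
  if_neg fun hc => absurd (hc i) (not_le.mpr h)

lemma alternatingSum_empty (a : Fin k → ℕ) (S : Finset (Fin k)) :
    alternatingSum a S ∅ = Nat.multinomial univ a := by
  have : sumBound a S ∅ = 0 := by
    funext
    simp [sumBound]
  simp [alternatingSum, this, multinomialZ_natCast]

lemma alternatingSum_eq_add {a : Fin k → ℕ} {S U : Finset (Fin k)} {i : Fin k} (hU : i ∉ U) :
    alternatingSum (a + Pi.single i 1) S U = alternatingSum (a + Pi.single i 1) S (insert i U) +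
      alternatingSum a S (if i ∈ S then insert i U else U) := by
  have h1 : sumBound (a + Pi.single i 1) S (insert i U) =
      sumBound a S (if i ∈ S then insert i U else U) + Pi.single i 1 := by
    funext j
    rcases eq_or_ne j i with rfl | hj
    · by_cases hS : j ∈ S <;> simp [sumBound, hS, hU]
    · by_cases hS : i ∈ S <;> simp [sumBound, hS, hj]
  have h2 : Function.update (sumBound a S (if i ∈ S then insert i U else U)) i 0 =
      sumBound (a + Pi.single i 1) S U := by
    funext j
    rcases eq_or_ne j i with rfl | hj
    · simp [sumBound, hU]
    · by_cases hS : i ∈ S <;> simp [sumBound, hS, hj]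
  have h3 (b : Fin k → ℕ) : (-1 : ℤ) ^ (∑ j, (b + Pi.single i 1 : Fin k → ℕ) j) *
        multinomialZ (fun j => ((a + Pi.single i 1 : Fin k → ℕ) j : ℤ) -
          (b + Pi.single i 1 : Fin k → ℕ) j) =
      -((-1) ^ (∑ j, b j) * multinomialZ (fun j => (a j : ℤ) - b j)) := by
    simp [sum_add_distrib, pow_succ]
  rw [alternatingSum, alternatingSum, alternatingSum, h1, sum_Icc_add_single, h2]
  simp only [h3, sum_neg_distrib]
  ring

lemma alternatingSum_insert_of_eq_zero {a : Fin k → ℕ} {S U : Finset (Fin k)} {i : Fin k}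
    (hU : i ∉ U) (ha : a i = 0) : alternatingSum a S (insert i U) = alternatingSum a S U := by
  refine (sum_subset (Icc_subset_Icc le_rfl fun j => ?_) fun b hb hb' => ?_).symm
  · simp only [sumBound, mem_insert]
    split_ifs <;> simp_all
  · have hbi : 0 < b i := by
      by_contra h0
      refine hb' (mem_Icc.mpr ⟨fun _ => Nat.zero_le _, fun j => ?_⟩)
      have := (mem_Icc.mp hb).2 j
      rcases eq_or_ne j i with rfl | hj
      · simp [Nat.eq_zero_of_not_pos h0]
      · simpa [sumBound, hj] using this
    rw [multinomialZ_eq_zero (i := i) (by simp [ha, hbi]), mul_zero]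

end alternatingSum

lemma numFiberDer_eq_alternatingSum {n k : ℕ} {β : Fin n → Fin k} (hβ : Monotone β)
    (S U : Finset (Fin k)) : (numFiberDer β S U : ℤ) = alternatingSum (fiberCard β) S U := by
  induction n generalizing U with
  | zero =>
    induction U using Finset.induction_on with
    | empty => rw [numFiberDer_empty hβ, alternatingSum_empty]
    | insert i U hi ih =>
      rw [numFiberDer_insert_of_forall_ne (fun x => x.elim0),
        alternatingSum_insert_of_eq_zero hi (by simp [fiberCard]), ih]
  | succ n ihn =>
    induction U using Finset.induction_on with
    | empty => rw [numFiberDer_empty hβ, alternatingSum_empty]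
    | insert i U hi ih =>
      by_cases h : ∃ p, β p = i
      · obtain ⟨p, rfl⟩ := h
        have h1 := numFiberDer_eq_add (S := S) hβ p hi
        have h2 := ihn (hβ.comp (Fin.strictMono_succAbove p).monotone)
          (if β p ∈ S then insert (β p) U else U)
        have h3 := alternatingSum_eq_add (a := fiberCard (β ∘ p.succAbove)) (S := S) hi
        rw [← fiberCard_eq_add_single] at h3
        rw [h1] at ih
        push_cast at ih
        linarith
      · push Not at h
        rw [numFiberDer_insert_of_forall_ne h,
          alternatingSum_insert_of_eq_zero hi (by simp [fiberCard, h]), ih]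

section blocks

variable {k : ℕ} (a : Fin k → ℕ)

/-- The index of the block containing `x`. -/
def blockIndex (x : Fin (∑ t, a t)) : Fin k := (finSigmaFinEquiv.symm x).1

lemma finSigmaFinEquiv_eq_blockStart_add (i : Fin k) (r : Fin (a i)) :
    (finSigmaFinEquiv ⟨i, r⟩ : ℕ) = blockStart a i + r := by
  rw [finSigmaFinEquiv_apply, blockStart, Nat.add_right_cancel_iff]
  refine sum_bij (fun t _ => Fin.castLE i.2.le t) (fun t _ => ?_)
    (fun _ _ _ _ h => Fin.castLE_injective _ h) (fun t ht => ?_) fun _ _ => rfl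
  · exact mem_Iio.mpr (Fin.lt_def.mpr t.2)
  · exact ⟨⟨t, Fin.lt_def.mp (mem_Iio.mp ht)⟩, mem_univ _, rfl⟩

variable {a}

lemma blockIndex_eq_iff {x : Fin (∑ t, a t)} {i : Fin k} :
    blockIndex a x = i ↔ inBlock a i x := by
  constructor
  · rintro rfl
    have h := finSigmaFinEquiv_eq_blockStart_add a _ (finSigmaFinEquiv.symm x).2
    rw [Sigma.eta, Equiv.apply_symm_apply] at h
    have h' : (x : ℕ) = blockStart a (blockIndex a x) + (finSigmaFinEquiv.symm x).2 := h
    have h2 : ((finSigmaFinEquiv.symm x).2 : ℕ) < a (blockIndex a x) :=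
      (finSigmaFinEquiv.symm x).2.2
    exact ⟨by omega, by omega⟩
  · rintro ⟨h1, h2⟩
    have h3 := finSigmaFinEquiv_eq_blockStart_add a i ⟨x - blockStart a i, by omega⟩
    have h4 := Fin.ext (h3.trans (Nat.add_sub_cancel' h1))
    rw [blockIndex, ← h4, Equiv.symm_apply_apply]

lemma blockStart_add_le {i j : Fin k} (h : i < j) : blockStart a i + a i ≤ blockStart a j := by
  rw [blockStart, blockStart, add_comm, ← sum_insert (by simp)]
  refine sum_le_sum_of_subset fun t ht => ?_
  simp only [mem_insert, mem_Iio] at ht ⊢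
  grind

lemma monotone_blockIndex : Monotone (blockIndex a) := by
  intro x y hxy
  by_contra! hlt
  have h1 := (blockIndex_eq_iff (x := x)).mp rfl
  have h2 := (blockIndex_eq_iff (x := y)).mp rfl
  have h3 := blockStart_add_le (a := a) hlt
  have h4 := Fin.le_def.mp hxy
  have h5 := h1.1
  have h6 := h2.2
  omega

lemma fiberCard_blockIndex : fiberCard (blockIndex a) = a := by
  funext i
  rw [fiberCard, ← Fintype.card_subtype, ← Fintype.card_fin (a i)]
  exact Fintype.card_congr ((finSigmaFinEquiv.symm.subtypeEquiv fun x => Iff.rfl).trans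
    (Equiv.sigmaSubtype i))

lemma isASPerm_iff {S : Finset (Fin k)} {π : Equiv.Perm (Fin (∑ t, a t))} :
    IsASPerm a S π ↔ IsFiberMono (blockIndex a) S π := by
  constructor
  · intro h x y hxy hb
    obtain ⟨d, hd⟩ := Nat.exists_eq_add_of_lt (Fin.lt_def.mp hxy)
    have hstep (z w : Fin (∑ t, a t)) (hzw : (w : ℕ) = z + 1)
        (hz : blockIndex a z = blockIndex a x) (hw : blockIndex a w = blockIndex a x) :
        if blockIndex a x ∈ S then π w < π z else π z < π w := by
      have h1 := h (blockIndex a x) z (blockIndex_eq_iff.mp hz).1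
        (hzw ▸ (blockIndex_eq_iff.mp hw).2)
      simpa [appl, ← hzw] using h1
    induction d generalizing y with
    | zero => exact hstep x y hd rfl hb.symm
    | succ d ih =>
      let z : Fin (∑ t, a t) := ⟨x + d + 1, by omega⟩
      have hxz : x < z := Fin.lt_def.mpr (by simp only [z]; omega)
      have hzy : z < y := Fin.lt_def.mpr (by simp only [z]; omega)
      have h1 := monotone_blockIndex hxz.le
      have h2 := monotone_blockIndex hzy.le
      have hz : blockIndex a x = blockIndex a z := by order
      have h3 := ih hxz hz rfl
      have h4 := hstep z y (by simp only [z]; omega) hz.symm hb.symm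
      split_ifs at h3 h4 ⊢ <;> order
  · intro h i j h1 h2
    have hn : blockStart a i + a i ≤ ∑ t, a t := by
      rw [blockStart, add_comm, ← sum_insert (by simp)]
      exact sum_le_sum_of_subset (subset_univ _)
    have hj : blockIndex a ⟨j, by omega⟩ = i := blockIndex_eq_iff.mpr ⟨h1, by simp only; omega⟩
    have hj' : blockIndex a ⟨j + 1, by omega⟩ = i :=
      blockIndex_eq_iff.mpr ⟨by simp only; omega, h2⟩
    have h3 := h (x := ⟨j, by omega⟩) (y := ⟨j + 1, by omega⟩) (Fin.lt_def.mpr (by simp))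
      (hj.trans hj'.symm)
    rw [hj] at h3
    have hj1 : j < ∑ t, a t := by omega
    have hj2 : j + 1 < ∑ t, a t := by omega
    simpa [appl, hj1, hj2] using h3

end blocks

/-- With `lᵢ = 1` for `i ∉ S` and `lᵢ = aᵢ` for `i ∈ S`, the number of
`(a,S)`-derangements is
`∑_{0 ≤ bₘ ≤ lₘ} (-1)^{∑ bᵢ} · multinomial(∑(aᵢ-bᵢ); a₁-b₁,…,a_k-b_k)`. -/
theorem numDer_sum (k : ℕ) (a : Fin k → ℕ) (S : Finset (Fin k)) :
    (numDer k a S : ℤ) =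
      ∑ b ∈ Finset.Icc (0 : Fin k → ℕ) (fun i => if i ∈ S then a i else 1),
        (-1 : ℤ) ^ (∑ i, b i) * multinomialZ (fun i => (a i : ℤ) - (b i : ℤ)) := by
  have h1 : numDer k a S = numFiberDer (blockIndex a) S univ := by
    simp [numDer, numFiberDer, isASPerm_iff]
  have h2 : sumBound a S univ = fun i => if i ∈ S then a i else 1 := by
    funext i
    simp [sumBound]
  rw [h1, numFiberDer_eq_alternatingSum monotone_blockIndex, fiberCard_blockIndex,
    alternatingSum, h2]
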